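/- Let d ∈ {5, 6, 10, 13, 15, 22, 35, 37, 51, 58, 91, 115, 123, 187, 235, 267, 403, 427}, and for n ≥ 1 let r_d(n) = #{(a,b) ∈ ℤ × ℤ : Q_d(a,b) = n} + #{(x,y) ∈ ℤ × ℤ : f_d(x,y) = n}. Let p be a prime and e ≥ 0 an integer. If p is odd with Legendre symbol (d_K/p) = 1, or p = 2 with d_K ≡ 1 (mod 8), then r_d(p^e) = 2(e+1). If p is odd with (d_K/p) = −1, or p = 2 with d_K ≡ 5 (mod 8), then r_d(p^e) = 1 + (−1)^e. If p divides d_K, then r_d(p^e) = 2. -/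

import Mathlib

/-- The norm form `Q_d` of the principal ideal class of `ℚ(√−d)` on `ℤ²`:
`a² + d·b²` if `d ≡ 1, 2 (mod 4)`, and `a² + a·b + ((1+d)/4)·b²` if `d ≡ 3 (mod 4)`. -/
def Qf (d : ℕ) (p : ℤ × ℤ) : ℤ :=
  if d % 4 = 3 then p.1 ^ 2 + p.1 * p.2 + (((1 + d) / 4 : ℕ) : ℤ) * p.2 ^ 2
  else p.1 ^ 2 + (d : ℤ) * p.2 ^ 2

/-- The coefficients `(A, B, C)` of the reduced binary quadratic form
`f_d(x,y) = A·x² + B·x·y + C·y²` attached to the nonprincipal ideal class of `ℚ(√−d)`,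
for each squarefree `d` with class number 2. -/
def npABC (d : ℕ) : ℤ × ℤ × ℤ :=
  if d = 5 then (2, 2, 3)
  else if d = 6 then (2, 0, 3)
  else if d = 10 then (2, 0, 5)
  else if d = 13 then (2, 2, 7)
  else if d = 15 then (2, 1, 2)
  else if d = 22 then (2, 0, 11)
  else if d = 35 then (3, 1, 3)
  else if d = 37 then (2, 2, 19)
  else if d = 51 then (3, 3, 5)
  else if d = 58 then (2, 0, 29)
  else if d = 91 then (5, 3, 5)
  else if d = 115 then (5, 5, 7)
  else if d = 123 then (3, 3, 11)
  else if d = 187 then (7, 3, 7)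
  else if d = 235 then (5, 5, 13)
  else if d = 267 then (3, 3, 23)
  else if d = 403 then (11, 9, 11)
  else (7, 7, 17)

/-- The nonprincipal form `f_d(x,y) = A·x² + B·x·y + C·y²`. -/
def fnp (d : ℕ) (p : ℤ × ℤ) : ℤ :=
  (npABC d).1 * p.1 ^ 2 + (npABC d).2.1 * p.1 * p.2 + (npABC d).2.2 * p.2 ^ 2

/-- The discriminant `d_K` of `ℚ(√−d)` for a squarefree positive integer `d`:
`−4d` if `d ≡ 1, 2 (mod 4)` and `−d` if `d ≡ 3 (mod 4)`. -/
def discK (d : ℕ) : ℤ := if d % 4 = 3 then -(d : ℤ) else -4 * (d : ℤ)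

/-- The total number of lattice points of norm `n` in the two ideal lattices `L_o` and `L_a`:
`r_d(n) = #{(a,b) ∈ ℤ² : Q_d(a,b) = n} + #{(x,y) ∈ ℤ² : f_d(x,y) = n}`. -/
noncomputable def rShell (d n : ℕ) : ℕ :=
  Nat.card {p : ℤ × ℤ // Qf d p = (n : ℤ)} + Nat.card {p : ℤ × ℤ // fnp d p = (n : ℤ)}


/-- Representations of `n` by `a x² + b x y + c y²`. -/
def repSet (a b c n : ℤ) : Set (ℤ × ℤ) :=
  {v | a * v.1 ^ 2 + b * v.1 * v.2 + c * v.2 ^ 2 = n}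

/-- Number of representations. -/
noncomputable def cnt (a b c n : ℤ) : ℕ := (repSet a b c n).ncard

theorem ncard_eq_of_maps {S T : Set (ℤ × ℤ)} (f g : ℤ × ℤ → ℤ × ℤ)
    (hf : ∀ v ∈ S, f v ∈ T) (hg : ∀ v ∈ T, g v ∈ S)
    (hgf : ∀ v ∈ S, g (f v) = v) (hfg : ∀ v ∈ T, f (g v) = v) : S.ncard = T.ncard := by
  apply Set.ncard_congr (fun v _ => f v) (fun v hv => hf v hv)
  · intro v w hv hw h
    rw [← hgf v hv, ← hgf w hw]; exact congrArg g h
  · intro v hv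
    exact ⟨g v, hg v hv, hfg v hv⟩

theorem cnt_flip (a b c n : ℤ) : cnt a (-b) c n = cnt a b c n := by
  apply ncard_eq_of_maps (fun v => (v.1, -v.2)) (fun v => (v.1, -v.2)) <;>
    simp [repSet]

theorem cnt_swap (a b c n : ℤ) : cnt c b a n = cnt a b c n := by
  apply ncard_eq_of_maps (fun v => (v.2, v.1)) (fun v => (v.2, v.1)) <;>
    simp only [repSet, Set.mem_ofPred_eq] <;> intro v hv <;> first | trivial | linarith

theorem cnt_shift (a b c q n : ℤ) :
    cnt a (b + 2 * a * q) (c + b * q + a * q ^ 2) n = cnt a b c n := by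
  apply ncard_eq_of_maps (fun v => (v.1 + q * v.2, v.2)) (fun v => (v.1 - q * v.2, v.2)) <;>
    simp only [repSet, Set.mem_ofPred_eq] <;> intro v hv
  · linarith
  · linarith
  · ext <;> simp
  · ext <;> simp

theorem rep_finite (a b c n : ℤ) (ha : 0 < a) (hD : b ^ 2 - 4 * a * c < 0) :
    (repSet a b c n).Finite := by
  have hc : 0 < c := by nlinarith [sq_nonneg b]
  apply Set.Finite.subset (Set.finite_Icc ((-(4 * c * n), -(4 * a * n)) : ℤ × ℤ)
    (4 * c * n, 4 * a * n))
  rintro ⟨x, y⟩ h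
  simp only [repSet, Set.mem_ofPred_eq] at h
  have h1 : y ^ 2 ≤ 4 * a * n := by
    nlinarith [sq_nonneg (2 * a * x + b * y), mul_nonneg (by linarith : 0 ≤ 4 * a * c - b ^ 2 - 1) (sq_nonneg y)]
  have h2 : x ^ 2 ≤ 4 * c * n := by
    nlinarith [sq_nonneg (2 * c * y + b * x), mul_nonneg (by linarith : 0 ≤ 4 * a * c - b ^ 2 - 1) (sq_nonneg x)]
  have key : ∀ t M : ℤ, t ^ 2 ≤ M → -M ≤ t ∧ t ≤ M := by
    intro t M h
    have := Int.le_self_sq t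
    have := Int.le_self_sq (-t)
    constructor <;> nlinarith
  obtain ⟨h3, h4⟩ := key _ _ h1
  obtain ⟨h5, h6⟩ := key _ _ h2
  exact ⟨⟨h5, h3⟩, ⟨h6, h4⟩⟩

/-- Gauss reduction. -/
theorem reduce (N : ℕ) : ∀ (a b c : ℤ), a.toNat ≤ N → 0 < a → b ^ 2 - 4 * a * c < 0 →
    ∃ a' b' c' : ℤ, 0 < a' ∧ 0 ≤ b' ∧ b' ≤ a' ∧ a' ≤ c' ∧
      b' ^ 2 - 4 * a' * c' = b ^ 2 - 4 * a * c ∧ ∀ n, cnt a b c n = cnt a' b' c' n := by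
  induction N with
  | zero => intro a b c h ha; omega
  | succ N ih =>
    intro a b c hN ha hD
    obtain ⟨q, hq1, hq2⟩ : ∃ q : ℤ, -a ≤ b + 2 * a * q ∧ b + 2 * a * q ≤ a := by
      refine ⟨-((b + a) / (2 * a)), ?_⟩
      have h1 := Int.emod_add_mul_ediv (b + a) (2 * a)
      have h2 := Int.emod_nonneg (b + a) (by omega : (2 * a) ≠ 0)
      have h3 := Int.emod_lt_of_pos (b + a) (by omega : 0 < (2 * a))
      constructor <;> nlinarith
    have hs := cnt_shift a b c q
    have hd : (b + 2 * a * q) ^ 2 - 4 * a * (c + b * q + a * q ^ 2) = b ^ 2 - 4 * a * c := by ring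
    generalize b + 2 * a * q = b1 at *
    generalize c + b * q + a * q ^ 2 = c1 at *
    have hc1 : 0 < c1 := by nlinarith [sq_nonneg b1]
    by_cases hle : a ≤ c1
    · by_cases hb : 0 ≤ b1
      · exact ⟨a, b1, c1, ha, hb, hq2, hle, hd, fun n => (hs n).symm⟩
      · refine ⟨a, -b1, c1, ha, by omega, by omega, hle, by rw [← hd]; ring, fun n => ?_⟩
        rw [cnt_flip, hs]
    · obtain ⟨a', b', c', h1, h2, h3, h4, h5, h6⟩ := ih c1 b1 a (by omega) hc1 (by nlinarith)
      refine ⟨a', b', c', h1, h2, h3, h4, by rw [h5, ← hd]; ring, fun n => ?_⟩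
      rw [← h6, cnt_swap a b1 c1, hs]

/-- Passing to the index `A` sublattice when `A` is ramified. -/
theorem cnt_ram (A a b c n : ℤ) (hA : Prime A) (h : ¬ A ∣ a) :
    cnt a (A * b) (A * c) (A * n) = cnt (A * a) (A * b) c n := by
  have hA0 : A ≠ 0 := hA.ne_zero
  symm
  apply ncard_eq_of_maps (fun v => (A * v.1, v.2)) (fun v => (v.1 / A, v.2)) <;>
    simp only [repSet, Set.mem_ofPred_eq] <;> intro v hv
  · rw [← hv]; ring
  all_goals try
    have hd : A ∣ v.1 := by
      have : A ∣ a * v.1 ^ 2 := ⟨n - b * v.1 * v.2 - c * v.2 ^ 2, by linarith⟩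
      rcases hA.dvd_or_dvd this with h' | h'
      · exact absurd h' h
      · exact hA.dvd_of_dvd_pow h'
    obtain ⟨t, ht⟩ := hd
    rw [ht, Int.mul_ediv_cancel_left _ hA0]
    rw [ht] at hv
    apply mul_left_cancel₀ hA0
    linarith
  · ext <;> simp [hA0]
  · have hd : A ∣ v.1 := by
      have : A ∣ a * v.1 ^ 2 := ⟨n - b * v.1 * v.2 - c * v.2 ^ 2, by linarith⟩
      rcases hA.dvd_or_dvd this with h' | h'
      · exact absurd h' h
      · exact hA.dvd_of_dvd_pow h'
    ext
    · exact Int.mul_ediv_cancel' hd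
    · rfl

theorem sub_card (p a b c k m n : ℤ) (hp : p ≠ 0) (hk : a * k ^ 2 + b * k + c = p * m) :
    ({v | v ∈ repSet a b c (p * n) ∧ p ∣ v.1 - k * v.2} : Set (ℤ × ℤ)).ncard =
      cnt (p * a) (2 * a * k + b) m n := by
  symm
  apply ncard_eq_of_maps (fun v => (p * v.1 + k * v.2, v.2))
    (fun v => ((v.1 - k * v.2) / p, v.2)) <;>
    simp only [repSet, Set.mem_ofPred_eq] <;> intro v hv
  · constructor
    · rw [← hv]
      linear_combination v.2 ^ 2 * hk
    · simp
  · obtain ⟨hv, t, ht⟩ := hv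
    rw [ht, Int.mul_ediv_cancel_left _ hp]
    have : v.1 = p * t + k * v.2 := by linarith
    rw [this] at hv
    apply mul_left_cancel₀ hp
    linear_combination hv - v.2 ^ 2 * hk
  · ext <;> simp [hp]
  · ext
    · show p * ((v.1 - k * v.2) / p) + k * v.2 = v.1
      rw [Int.mul_ediv_cancel' hv.2]; ring
    · rfl

/-- Points of the form both of whose coordinates are divisible by `p`. -/
def pSet (p a b c n : ℤ) : Set (ℤ × ℤ) := {v | v ∈ repSet a b c n ∧ p ∣ v.1 ∧ p ∣ v.2}

theorem pSet_card (p a b c n : ℤ) (hp : p ≠ 0) :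
    (pSet p a b c (p * (p * n))).ncard = cnt a b c n := by
  symm
  apply ncard_eq_of_maps (fun v => (p * v.1, p * v.2)) (fun v => (v.1 / p, v.2 / p)) <;>
    simp only [pSet, repSet, Set.mem_ofPred_eq] <;> intro v hv
  · refine ⟨?_, by simp, by simp⟩
    rw [← hv]; ring
  · obtain ⟨hv, ⟨s, hs⟩, t, ht⟩ := hv
    rw [hs, ht, Int.mul_ediv_cancel_left _ hp, Int.mul_ediv_cancel_left _ hp]
    rw [hs, ht] at hv
    apply mul_left_cancel₀ hp
    apply mul_left_cancel₀ hp
    linarith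
  · ext <;> simp [hp]
  · ext
    · exact Int.mul_ediv_cancel' hv.2.1
    · exact Int.mul_ediv_cancel' hv.2.2

theorem pSet_empty (p a b c n : ℤ) (hp : Prime p) (hn : ¬ p ∣ n) :
    pSet p a b c (p * n) = ∅ := by
  ext v
  simp only [pSet, repSet, Set.mem_ofPred_eq, Set.mem_empty_iff_false, iff_false]
  rintro ⟨hv, ⟨s, hs⟩, t, ht⟩
  apply hn
  rw [hs, ht] at hv
  refine ⟨a * s ^ 2 + b * s * t + c * t ^ 2, ?_⟩
  apply mul_left_cancel₀ hp.ne_zero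
  linarith

theorem root_split (p a δ c k m n : ℤ) (hp : Prime p) (hpa : ¬ p ∣ a)
    (hk : a * k ^ 2 + (δ * a) * k + c = p * m) (v : ℤ × ℤ) (hv : v ∈ repSet a (δ * a) c (p * n)) :
    p ∣ v.1 - k * v.2 ∨ p ∣ v.1 - (-k - δ) * v.2 := by
  simp only [repSet, Set.mem_ofPred_eq] at hv
  have : p ∣ a * ((v.1 - k * v.2) * (v.1 - (-k - δ) * v.2)) :=
    ⟨n - m * v.2 ^ 2, by linear_combination hv - v.2 ^ 2 * hk⟩
  exact hp.dvd_or_dvd ((hp.dvd_or_dvd this).resolve_left hpa)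

theorem split_rec (p a δ c k m n : ℤ) (hp : Prime p) (hpa : ¬ p ∣ a)
    (hk : a * k ^ 2 + (δ * a) * k + c = p * m) (ha : 0 < a)
    (hD : (δ * a) ^ 2 - 4 * a * c < 0) (hh : ¬ p ∣ 2 * k + δ) :
    cnt a (δ * a) c (p * n) + (pSet p a (δ * a) c (p * n)).ncard =
      2 * cnt (p * a) (2 * a * k + δ * a) m n := by
  have h1 := sub_card p a (δ * a) c k m n hp.ne_zero hk
  have h2 := sub_card p a (δ * a) c (-k - δ) m n hp.ne_zero (by rw [← hk]; ring)
  rw [show 2 * a * (-k - δ) + δ * a = -(2 * a * k + δ * a) by ring, cnt_flip] at h2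
  have hfin := rep_finite a (δ * a) c (p * n) ha hD
  have h3 := Set.ncard_union_add_ncard_inter
    {v | v ∈ repSet a (δ * a) c (p * n) ∧ p ∣ v.1 - k * v.2}
    {v | v ∈ repSet a (δ * a) c (p * n) ∧ p ∣ v.1 - (-k - δ) * v.2}
    (hfin.subset fun v hv => hv.1) (hfin.subset fun v hv => hv.1)
  rw [h1, h2] at h3
  rw [two_mul, ← h3]
  unfold cnt pSet
  congr 2
  · ext v
    constructor
    · intro hv
      rcases root_split p a δ c k m n hp hpa hk v hv with h | h
      · exact Or.inl ⟨hv, h⟩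
      · exact Or.inr ⟨hv, h⟩
    · rintro (h | h) <;> exact h.1
  · ext v
    constructor
    · rintro ⟨h, hx, hy⟩
      exact ⟨⟨h, dvd_sub hx (hy.mul_left _)⟩, ⟨h, dvd_sub hx (hy.mul_left _)⟩⟩
    · rintro ⟨⟨h, hx⟩, -, hy⟩
      have : p ∣ (2 * k + δ) * v.2 := by
        have := dvd_sub hy hx
        ring_nf at this ⊢
        exact this
      have h2 := (hp.dvd_or_dvd this).resolve_left hh
      refine ⟨h, ?_, h2⟩
      have := dvd_add hx (h2.mul_left k)
      simpa using this

theorem ram_rec (p a δ c k m n : ℤ) (hp : Prime p) (hpa : ¬ p ∣ a)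
    (hk : a * k ^ 2 + (δ * a) * k + c = p * m) (hh : p ∣ 2 * k + δ) :
    cnt a (δ * a) c (p * n) = cnt (p * a) (2 * a * k + δ * a) m n := by
  rw [← sub_card p a (δ * a) c k m n hp.ne_zero hk]
  unfold cnt
  congr 1
  ext v
  constructor
  · intro hv
    refine ⟨hv, ?_⟩
    rcases root_split p a δ c k m n hp hpa hk v hv with h | h
    · exact h
    · have := dvd_sub h (hh.mul_right v.2)
      ring_nf at this ⊢
      exact this
  · exact fun h => h.1

theorem inert_eq (p a b c n : ℤ) (hp : Prime p) (hpa : ¬ p ∣ a)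
    (hk : ∀ k, ¬ p ∣ a * k ^ 2 + b * k + c) :
    cnt a b c (p * n) = (pSet p a b c (p * n)).ncard := by
  unfold cnt
  congr 1
  ext v
  refine ⟨fun hv => ?_, fun h => h.1⟩
  have hv' := hv
  simp only [repSet, Set.mem_ofPred_eq] at hv
  have hy : p ∣ v.2 := by
    by_contra hy
    have hc : IsCoprime p v.2 := (hp.irreducible.coprime_iff_not_dvd).2 hy
    obtain ⟨s, t, hst⟩ := hc
    apply hk (v.1 * t)
    -- t * v.2 = 1 - s p
    have : p ∣ v.2 ^ 2 * (a * (v.1 * t) ^ 2 + b * (v.1 * t) + c) := by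
      refine ⟨n + a * v.1 ^ 2 * (-2 * s + p * s ^ 2) - b * v.1 * v.2 * s, ?_⟩
      have e : t * v.2 = 1 - s * p := by linarith
      linear_combination hv + (a * v.1 ^ 2 * (t * v.2 + 1 - s * p) + b * v.1 * v.2) * e
    rcases hp.dvd_or_dvd this with h | h
    · exact absurd (hp.dvd_of_dvd_pow h) hy
    · exact h
  refine ⟨hv', ?_, hy⟩
  obtain ⟨t, ht⟩ := hy
  have : p ∣ a * v.1 ^ 2 := ⟨n - b * v.1 * t - c * t * v.2, by
    rw [ht] at hv ⊢; linarith⟩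
  exact hp.dvd_of_dvd_pow ((hp.dvd_or_dvd this).resolve_left hpa)

/-- The two concordant forms. -/
structure Good (A ε C : ℤ) : Prop where
  pr : Prime A
  pos : 0 < A
  eps : ε = 0 ∨ ε = 1
  ndvd : ¬ A ∣ C
  disc : 4 * A < 4 * A * C - (ε * A) ^ 2
  even : (2 : ℤ) ∣ (ε * A) ^ 2 - 4 * A * C → A = 2
  red : ∀ a b c : ℤ, 0 < a → b ^ 2 - 4 * a * c = (ε * A) ^ 2 - 4 * A * C →
    (∀ n, cnt a b c n = cnt 1 (ε * A) (A * C) n) ∨ (∀ n, cnt a b c n = cnt A (ε * A) C n)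

/-- Total count. -/
noncomputable def tot (A ε C n : ℤ) : ℕ := cnt 1 (ε * A) (A * C) n + cnt A (ε * A) C n

theorem sq_mod8 (A : ℤ) (h : A % 2 = 1) : A ^ 2 % 8 = 1 := by
  obtain ⟨t, rfl⟩ : ∃ t, A = 2 * t + 1 := ⟨A / 2, by omega⟩
  obtain ⟨u, hu⟩ := (Int.even_mul_succ_self t).two_dvd
  rw [show (2 * t + 1) ^ 2 = 4 * (t * (t + 1)) + 1 by ring, hu]
  omega

namespace Good
variable {A ε C : ℤ}

theorem QA (g : Good A ε C) (n : ℤ) : cnt 1 (ε * A) (A * C) (A * n) = cnt A (ε * A) C n := by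
  have := cnt_ram A 1 ε C n g.pr g.pr.not_dvd_one
  rwa [mul_comm A ε, mul_one] at this

theorem fA (g : Good A ε C) (n : ℤ) : cnt A (ε * A) C (A * n) = cnt 1 (ε * A) (A * C) n := by
  have := cnt_ram A C ε 1 n g.pr g.ndvd
  rwa [mul_comm A ε, mul_one, cnt_swap, cnt_swap 1] at this

theorem one (g : Good A ε C) : tot A ε C 1 = 2 := by
  have hd := g.disc
  have hA := g.pos
  have h1 : repSet 1 (ε * A) (A * C) 1 = {((1 : ℤ), (0 : ℤ)), (-1, 0)} := by
    ext ⟨x, y⟩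
    simp only [repSet, Set.mem_ofPred_eq, Set.mem_insert_iff, Set.mem_singleton_iff, Prod.mk.injEq]
    constructor
    · intro h
      have hy : y = 0 := by
        by_contra hy
        have : 0 < y ^ 2 := by positivity
        nlinarith [sq_nonneg (2 * x + ε * A * y), mul_nonneg (by linarith : 0 ≤ 4 * A * C - (ε * A) ^ 2) (by linarith : 0 ≤ y ^ 2 - 1)]
      subst hy
      have : x ^ 2 = 1 := by linarith
      rcases mul_self_eq_one_iff.1 (by linarith : x * x = 1) with h | h <;> simp [h]
    · rintro (⟨rfl, rfl⟩ | ⟨rfl, rfl⟩) <;> ring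
  have h2 : repSet A (ε * A) C 1 = ∅ := by
    ext ⟨x, y⟩
    simp only [repSet, Set.mem_ofPred_eq, Set.mem_empty_iff_false, iff_false]
    intro h
    have hy : y = 0 := by
      by_contra hy
      have : 0 < y ^ 2 := by positivity
      nlinarith [sq_nonneg (2 * A * x + ε * A * y), mul_nonneg (by linarith : 0 ≤ 4 * A * C - (ε * A) ^ 2) (by linarith : 0 ≤ y ^ 2 - 1)]
    subst hy
    exact g.pr.not_dvd_one ⟨x ^ 2, by linarith⟩
  unfold tot cnt
  rw [h1, h2, Set.ncard_pair (by simp)]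
  simp

/-- The neighbour forms together have the same count. -/
theorem neighbour (g : Good A ε C) (p k m n : ℤ) (hp : 0 < p) (hpr : Prime p) (hpA : ¬ A ∣ p)
    (hk : A * k ^ 2 + (ε * A) * k + C = p * m) :
    cnt (p * 1) (2 * 1 * (A * k) + ε * A) (A * m) n + cnt (p * A) (2 * A * k + ε * A) m n
      = tot A ε C n := by
  have h : ∀ n, cnt p (2 * A * k + ε * A) (A * m) (A * n) =
      cnt (p * A) (2 * A * k + ε * A) m n := by
    intro n
    have := cnt_ram A p (2 * k + ε) m n g.pr hpA
    rw [show A * (2 * k + ε) = 2 * A * k + ε * A by ring, mul_comm A p] at this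
    exact this
  rw [show p * 1 = p by ring, show 2 * 1 * (A * k) + ε * A = 2 * A * k + ε * A by ring, ← h]
  rcases g.red p (2 * A * k + ε * A) (A * m) hp (by linear_combination (4 * A) * hk) with h' | h'
  · rw [h', h', g.QA]; rfl
  · rw [h', h', g.fA, add_comm]; rfl

theorem discneg (g : Good A ε C) : (ε * A) ^ 2 - 4 * A * C < 0 := by
  linarith [g.disc, g.pos]

theorem kk (p k m : ℤ) (hk : A * k ^ 2 + (ε * A) * k + C = p * m) :
    1 * (A * k) ^ 2 + ((ε * A) * 1) * (A * k) + A * C = p * (A * m) := by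
  linear_combination A * hk

theorem split (g : Good A ε C) (p k m n : ℤ) (hp : 0 < p) (hpr : Prime p) (hpA : ¬ A ∣ p)
    (hpA' : ¬ p ∣ A)
    (hk : A * k ^ 2 + (ε * A) * k + C = p * m) (hh : ¬ p ∣ 2 * k + ε) :
    tot A ε C (p * n) + ((pSet p 1 (ε * A) (A * C) (p * n)).ncard +
      (pSet p A (ε * A) C (p * n)).ncard) = 2 * tot A ε C n := by
  have h1 := split_rec p A ε C k m n hpr hpA' hk g.pos g.discneg hh
  have h2 := split_rec p 1 (ε * A) (A * C) (A * k) (A * m) n hpr hpr.not_dvd_one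
    (kk p k m hk) one_pos (by linarith [g.discneg]) (by
      rw [show 2 * (A * k) + ε * A = A * (2 * k + ε) by ring]
      intro h
      exact (hpr.dvd_or_dvd h).elim hpA' hh)
  have h3 := g.neighbour p k m n hp hpr hpA hk
  rw [mul_one (ε * A)] at h2
  unfold tot at *
  omega

theorem ram (g : Good A ε C) (p k m n : ℤ) (hp : 0 < p) (hpr : Prime p) (hpA : ¬ A ∣ p)
    (hpA' : ¬ p ∣ A)
    (hk : A * k ^ 2 + (ε * A) * k + C = p * m) (hh : p ∣ 2 * k + ε) :
    tot A ε C (p * n) = tot A ε C n := by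
  have h1 := ram_rec p A ε C k m n hpr hpA' hk hh
  have h2 := ram_rec p 1 (ε * A) (A * C) (A * k) (A * m) n hpr hpr.not_dvd_one
    (kk p k m hk) (by
      rw [show 2 * (A * k) + ε * A = A * (2 * k + ε) by ring]
      exact hh.mul_left _)
  have h3 := g.neighbour p k m n hp hpr hpA hk
  rw [mul_one (ε * A)] at h2
  unfold tot at *
  omega

theorem inert (g : Good A ε C) (p n : ℤ) (hpr : Prime p)
    (hpA' : ¬ p ∣ A) (hk : ∀ k, ¬ p ∣ A * k ^ 2 + (ε * A) * k + C) :
    tot A ε C (p * n) = ((pSet p 1 (ε * A) (A * C) (p * n)).ncard +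
      (pSet p A (ε * A) C (p * n)).ncard) := by
  unfold tot
  rw [inert_eq p A (ε * A) C n hpr hpA' hk, inert_eq p 1 (ε * A) (A * C) n hpr hpr.not_dvd_one]
  intro l hl
  have hc : IsCoprime p A := (hpr.irreducible.coprime_iff_not_dvd).2 hpA'
  obtain ⟨s, t, hst⟩ := hc
  apply hk (t * l)
  have : p ∣ A * (A * (t * l) ^ 2 + (ε * A) * (t * l) + C) := by
    obtain ⟨u, hu⟩ := hl
    refine ⟨u + l ^ 2 * (-2 * s + p * s ^ 2) - ε * A * l * s, ?_⟩
    have e : t * A = 1 - s * p := by linarith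
    linear_combination hu + (l ^ 2 * (t * A + 1 - s * p) + ε * A * l) * e
  exact (hpr.dvd_or_dvd this).resolve_left hpA'

theorem exists_root (p s : ℤ) (hpr : Prime p) (hp2 : ¬ p ∣ 2) (hpA : ¬ p ∣ A)
    (hs : p ∣ s ^ 2 - ((ε * A) ^ 2 - 4 * A * C)) :
    ∃ k, p ∣ A * k ^ 2 + (ε * A) * k + C := by
  have h2A : ¬ p ∣ 2 * A := fun h => (hpr.dvd_or_dvd h).elim hp2 hpA
  obtain ⟨u, t, hut⟩ := (hpr.irreducible.coprime_iff_not_dvd).2 h2A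
  refine ⟨t * (s - ε * A), ?_⟩
  have : p ∣ (2 * (2 * A)) * (A * (t * (s - ε * A)) ^ 2 + (ε * A) * (t * (s - ε * A)) + C) := by
    have h1 : p ∣ 2 * A * (t * (s - ε * A)) + ε * A - s := by
      refine ⟨-u * (s - ε * A), ?_⟩
      linear_combination (s - ε * A) * hut
    have h2 := dvd_add (h1.mul_right (2 * A * (t * (s - ε * A)) + ε * A + s)) hs
    ring_nf at h2 ⊢
    exact h2
  rcases hpr.dvd_or_dvd this with h | h
  · rcases hpr.dvd_or_dvd h with h | h
    · exact absurd h hp2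
    · exact absurd h h2A
  · exact h

theorem main (g : Good A ε C) (p : ℕ) [hp : Fact p.Prime] (e : ℕ) :
    (((p ≠ 2 ∧ legendreSym p ((ε * A) ^ 2 - 4 * A * C) = 1) ∨
        (p = 2 ∧ ((ε * A) ^ 2 - 4 * A * C) % 8 = 1)) →
      tot A ε C ((p : ℤ) ^ e) = 2 * (e + 1)) ∧
    (((p ≠ 2 ∧ legendreSym p ((ε * A) ^ 2 - 4 * A * C) = -1) ∨
        (p = 2 ∧ ((ε * A) ^ 2 - 4 * A * C) % 8 = 5)) →
      (tot A ε C ((p : ℤ) ^ e) : ℤ) = 1 + (-1) ^ e) ∧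
    ((p : ℤ) ∣ ((ε * A) ^ 2 - 4 * A * C) → tot A ε C ((p : ℤ) ^ e) = 2) := by
  have hpr : Prime (p : ℤ) := Nat.prime_iff_prime_int.1 hp.out
  have hpos : (0 : ℤ) < p := by exact_mod_cast hp.out.pos
  have hp2 : p ≠ 2 → ¬ (p : ℤ) ∣ 2 := by
    intro h h'
    have : p ∣ 2 := by exact_mod_cast h'
    exact h ((Nat.prime_dvd_prime_iff_eq hp.out Nat.prime_two).1 this)
  have hAp : ¬ (p : ℤ) ∣ A → ¬ A ∣ p := fun h h' =>
    h ((g.pr.associated_of_dvd hpr h').symm.dvd)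
  have hAD : (p : ℤ) ∣ A → (p : ℤ) ∣ (ε * A) ^ 2 - 4 * A * C := by
    rintro ⟨t, rfl⟩
    exact ⟨ε ^ 2 * p * t ^ 2 - 4 * t * C, by ring⟩
  have key : ∀ k, A * (4 * (A * k ^ 2 + (ε * A) * k + C)) =
      (A * (2 * k + ε)) ^ 2 - ((ε * A) ^ 2 - 4 * A * C) := by intro k; ring
  -- the three coprimality facts
  have leg0 : ∀ {u : ℤ}, u ≠ 0 → legendreSym p ((ε * A) ^ 2 - 4 * A * C) = u →
      ¬ (p : ℤ) ∣ (ε * A) ^ 2 - 4 * A * C := by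
    intro u hu h hd
    rw [(legendreSym.eq_zero_iff p _).2 ((ZMod.intCast_zmod_eq_zero_iff_dvd _ p).2 hd)] at h
    exact hu h.symm
  refine ⟨?_, ?_, ?_⟩
  · intro h
    have hD : ¬ (p : ℤ) ∣ (ε * A) ^ 2 - 4 * A * C := by
      rcases h with ⟨_, h⟩ | ⟨rfl, h⟩
      · exact leg0 one_ne_zero h
      · push_cast; omega
    have hpA : ¬ (p : ℤ) ∣ A := fun h => hD (hAD h)
    obtain ⟨k, m, hk⟩ : ∃ k, (p : ℤ) ∣ A * k ^ 2 + (ε * A) * k + C := by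
      rcases h with ⟨h2, h⟩ | ⟨rfl, h⟩
      · have hs := (legendreSym.eq_one_iff p (fun h0 =>
          hD ((ZMod.intCast_zmod_eq_zero_iff_dvd _ p).1 h0))).1 h
        obtain ⟨s, hs⟩ := hs
        obtain ⟨s, rfl⟩ := ZMod.intCast_surjective s
        apply exists_root (p : ℤ) s hpr (hp2 h2) hpA
        rw [← ZMod.intCast_zmod_eq_zero_iff_dvd]
        push_cast at hs ⊢
        rw [hs]; ring
      · refine ⟨0, ?_⟩
        push_cast at *
        have hA2 : A % 2 = 1 := by omega
        rcases g.eps with rfl | rfl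
        · exfalso
          apply hD
          exact ⟨-2 * A * C, by ring⟩
        · have hsq : A ^ 2 % 8 = 1 := sq_mod8 A hA2
          have : (2 : ℤ) ∣ A * C := by
            rw [one_mul, mul_assoc] at h
            omega
          have := (hpr.dvd_or_dvd this).resolve_left hpA
          simpa using this
    have hh : ¬ (p : ℤ) ∣ 2 * k + ε := by
      intro hh
      apply hD
      have := key k
      rw [hk] at this
      rw [show (ε * A) ^ 2 - 4 * A * C = (A * (2 * k + ε)) ^ 2 - p * (A * 4 * m) by linarith]
      exact dvd_sub (dvd_pow (hh.mul_left _) two_ne_zero) (dvd_mul_right _ _)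
    have hrec := fun n => g.split p k m n hpos hpr (hAp hpA) hpA hk hh
    induction e using Nat.twoStepInduction with
    | zero => simpa using g.one
    | one =>
      have := hrec 1
      rw [pSet_empty _ _ _ _ _ hpr hpr.not_dvd_one, pSet_empty _ _ _ _ _ hpr hpr.not_dvd_one,
        g.one] at this
      simpa using this
    | more e ih1 ih2 =>
      have := hrec ((p : ℤ) * (p : ℤ) ^ e)
      rw [pSet_card _ _ _ _ _ hpr.ne_zero, pSet_card _ _ _ _ _ hpr.ne_zero] at this
      change _ + tot A ε C _ = _ at this
      rw [ih1, ← pow_succ', ih2, ← pow_succ'] at this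
      change tot A ε C ((p : ℤ) ^ (e + 1 + 1)) = _
      omega
  · intro h
    have hD : ¬ (p : ℤ) ∣ (ε * A) ^ 2 - 4 * A * C := by
      rcases h with ⟨_, h⟩ | ⟨rfl, h⟩
      · exact leg0 (by norm_num) h
      · push_cast; omega
    have hpA : ¬ (p : ℤ) ∣ A := fun h => hD (hAD h)
    have hk : ∀ k, ¬ (p : ℤ) ∣ A * k ^ 2 + (ε * A) * k + C := by
      rcases h with ⟨h2, h⟩ | ⟨rfl, h⟩
      · intro k ⟨m, hk⟩
        rw [legendreSym.eq_neg_one_iff] at h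
        apply h
        refine ⟨((A * (2 * k + ε) : ℤ) : ZMod p), ?_⟩
        have h1 := key k
        rw [hk] at h1
        have h2 : ((ε * A) ^ 2 - 4 * A * C) = (A * (2 * k + ε)) * (A * (2 * k + ε)) -
          p * (A * 4 * m) := by linarith
        rw [h2]
        push_cast
        simp
      · intro k hk
        push_cast at *
        have hA2 : A % 2 = 1 := by omega
        rcases g.eps with rfl | rfl
        · exact hD ⟨-2 * A * C, by ring⟩
        · have hsq : A ^ 2 % 8 = 1 := sq_mod8 A hA2
          have hC : (2 : ℤ) ∣ C := by
            have h1 : (2 : ℤ) ∣ k * (k + 1) := (Int.even_mul_succ_self k).two_dvd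
            have := dvd_sub hk (h1.mul_left A)
            ring_nf at this
            exact this
          have : (2 : ℤ) ∣ A * C := hC.mul_left A
          rw [one_mul, mul_assoc] at h
          omega
    have hrec := fun n => g.inert p n hpr hpA hk
    induction e using Nat.twoStepInduction with
    | zero => simp [g.one]
    | one =>
      have := hrec 1
      rw [pSet_empty _ _ _ _ _ hpr hpr.not_dvd_one, pSet_empty _ _ _ _ _ hpr hpr.not_dvd_one]
        at this
      simpa using this
    | more e ih1 ih2 =>
      have := hrec ((p : ℤ) * (p : ℤ) ^ e)
      rw [pSet_card _ _ _ _ _ hpr.ne_zero, pSet_card _ _ _ _ _ hpr.ne_zero] at this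
      change _ = tot A ε C _ at this
      rw [← pow_succ', ← pow_succ'] at this
      rw [this, ih1]
      ring
  · intro hD
    have hrec : ∀ n, tot A ε C (p * n) = tot A ε C n := by
      intro n
      by_cases hpA : (p : ℤ) ∣ A
      · have : (p : ℤ) = A := by
          have h1 := hpr.associated_of_dvd g.pr hpA
          exact Int.eq_of_associated_of_nonneg h1 hpos.le g.pos.le
        rw [this]
        unfold tot
        rw [g.QA, g.fA, add_comm]
      · have hne : p ≠ 2 := by
          rintro rfl
          apply hpA
          rw [g.even hD]; rfl
        obtain ⟨k, m, hk⟩ := exists_root (ε := ε) (C := C) (p : ℤ) 0 hpr (hp2 hne) hpA (by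
          have := dvd_neg.2 hD
          simpa using this)
        refine g.ram p k m n hpos hpr (hAp hpA) hpA hk ?_
        have h1 : (p : ℤ) ∣ (A * (2 * k + ε)) ^ 2 := by
          have := key k
          rw [hk] at this
          rw [show (A * (2 * k + ε)) ^ 2 = p * (A * 4 * m) + ((ε * A) ^ 2 - 4 * A * C) by linarith]
          exact dvd_add (dvd_mul_right _ _) hD
        exact (hpr.dvd_or_dvd (hpr.dvd_of_dvd_pow h1)).resolve_left hpA
    induction e with
    | zero => simp [g.one]
    | succ e ih => rw [pow_succ', hrec, ih]

end Good

theorem finish (d : ℕ) (A ε C b0 c0 a1 b1 c1 q : ℤ)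
    (hQ : ∀ v, Qf d v = 1 * v.1 ^ 2 + b0 * v.1 * v.2 + c0 * v.2 ^ 2)
    (hf : npABC d = (a1, b1, c1))
    (hdisc : discK d = (ε * A) ^ 2 - 4 * A * C)
    (hq : ε * A = b0 + 2 * 1 * q ∧ A * C = c0 + b0 * q + 1 * q ^ 2)
    (hf1 : (A = a1 ∧ ε * A = b1 ∧ C = c1) ∨
      (A = 2 * a1 - b1 ∧ ε * A = 2 * a1 - b1 ∧ C = a1 ∧ c1 = a1))
    (hA : A.natAbs.Prime) (hA0 : 0 < A) (hε : ε = 0 ∨ ε = 1) (hAC : ¬ A ∣ C)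
    (h4 : 4 * A < 4 * A * C - (ε * A) ^ 2)
    (h2 : (2 : ℤ) ∣ (ε * A) ^ 2 - 4 * A * C → A = 2)
    (hb : -427 ≤ (ε * A) ^ 2 - 4 * A * C)
    (hfin : ∀ a b c : ℤ, 0 < a → a ≤ 11 → 0 ≤ b → b ≤ a → a ≤ c →
      b ^ 2 - 4 * a * c = (ε * A) ^ 2 - 4 * A * C →
      (a = 1 ∧ b = b0 ∧ c = c0) ∨ (a = a1 ∧ b = b1 ∧ c = c1))
    (p : ℕ) [hp : Fact p.Prime] (e : ℕ) :
    (((p ≠ 2 ∧ legendreSym p (discK d) = 1) ∨ (p = 2 ∧ discK d % 8 = 1)) →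
      rShell d (p ^ e) = 2 * (e + 1)) ∧
    (((p ≠ 2 ∧ legendreSym p (discK d) = -1) ∨ (p = 2 ∧ discK d % 8 = 5)) →
      (rShell d (p ^ e) : ℤ) = 1 + (-1) ^ e) ∧
    ((p : ℤ) ∣ discK d → rShell d (p ^ e) = 2) := by
  have cQ : ∀ n, cnt 1 (ε * A) (A * C) n = cnt 1 b0 c0 n := by
    intro n
    rw [hq.1, hq.2, cnt_shift]
  have cf : ∀ n, cnt A (ε * A) C n = cnt a1 b1 c1 n := by
    intro n
    rcases hf1 with ⟨h, h', h''⟩ | ⟨h, h', h'', h'''⟩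
    · rw [h', h, h'']
    · rw [h', h, h'', h''', ← cnt_shift a1 b1 a1 (-1), ← cnt_swap, ← cnt_flip]
      congr 1 <;> ring
  have g : Good A ε C := by
    refine ⟨Int.prime_iff_natAbs_prime.2 hA, hA0, hε, hAC, h4, h2, ?_⟩
    intro a b c ha hD
    obtain ⟨a', b', c', h1, h2, h3, h4', h5, h6⟩ := reduce a.toNat a b c le_rfl ha (by linarith)
    have h11 : a' ≤ 11 := by
      by_contra h
      have : 12 ≤ a' := by omega
      nlinarith
    rcases hfin a' b' c' h1 h11 h2 h3 h4' (h5.trans hD) with ⟨rfl, rfl, rfl⟩ | ⟨rfl, rfl, rfl⟩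
    · left; intro n; rw [h6, cQ]
    · right; intro n; rw [h6, cf]
  have hr : rShell d (p ^ e) = tot A ε C ((p : ℤ) ^ e) := by
    unfold tot rShell
    rw [cQ, cf]
    simp only [hQ, fnp, hf, Nat.cast_pow]
    rfl
  rw [hr, hdisc]
  exact g.main p e

/-- For `d` in the list of squarefree values with `ℚ(√−d)` of class number 2, a prime `p` and
`e ≥ 0`: `r_d(p^e) = 2(e+1)` if `p` is odd with `(d_K/p) = 1` or `p = 2` with
`d_K ≡ 1 (mod 8)`; `r_d(p^e) = 1 + (−1)^e` if `p` is odd with `(d_K/p) = −1` or `p = 2`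
with `d_K ≡ 5 (mod 8)`; and `r_d(p^e) = 2` if `p ∣ d_K`. -/
theorem stmt_8 (d : ℕ)
    (hd : d ∈ ({5, 6, 10, 13, 15, 22, 35, 37, 51, 58, 91, 115, 123, 187, 235, 267, 403, 427} :
      Finset ℕ))
    (p : ℕ) [hp : Fact p.Prime] (e : ℕ) :
    (((p ≠ 2 ∧ legendreSym p (discK d) = 1) ∨ (p = 2 ∧ discK d % 8 = 1)) →
      rShell d (p ^ e) = 2 * (e + 1)) ∧
    (((p ≠ 2 ∧ legendreSym p (discK d) = -1) ∨ (p = 2 ∧ discK d % 8 = 5)) →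
      (rShell d (p ^ e) : ℤ) = 1 + (-1) ^ e) ∧
    ((p : ℤ) ∣ discK d → rShell d (p ^ e) = 2) := by
  simp only [Finset.mem_insert, Finset.mem_singleton] at hd
  rcases hd with rfl | rfl | rfl | rfl | rfl | rfl | rfl | rfl | rfl | rfl | rfl | rfl | rfl | rfl |
    rfl | rfl | rfl | rfl
  · exact finish _ 2 1 3 0 5 2 2 3 1 (by intro v; simp only [Qf]; norm_num) (by rfl) (by rfl) (by norm_num) (by norm_num)
      (by norm_num) (by norm_num) (by norm_num) (by norm_num) (by norm_num) (by norm_num)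
      (by norm_num) (by intro a b c h1 h2 h3 h4 h5 h6; norm_num at h6; interval_cases a <;> interval_cases b <;> omega) p e
  · exact finish _ 2 0 3 0 6 2 0 3 0 (by intro v; simp only [Qf]; norm_num) (by rfl) (by rfl) (by norm_num) (by norm_num)
      (by norm_num) (by norm_num) (by norm_num) (by norm_num) (by norm_num) (by norm_num)
      (by norm_num) (by intro a b c h1 h2 h3 h4 h5 h6; norm_num at h6; interval_cases a <;> interval_cases b <;> omega) p e
  · exact finish _ 2 0 5 0 10 2 0 5 0 (by intro v; simp only [Qf]; norm_num) (by rfl) (by rfl) (by norm_num) (by norm_num)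
      (by norm_num) (by norm_num) (by norm_num) (by norm_num) (by norm_num) (by norm_num)
      (by norm_num) (by intro a b c h1 h2 h3 h4 h5 h6; norm_num at h6; interval_cases a <;> interval_cases b <;> omega) p e
  · exact finish _ 2 1 7 0 13 2 2 7 1 (by intro v; simp only [Qf]; norm_num) (by rfl) (by rfl) (by norm_num) (by norm_num)
      (by norm_num) (by norm_num) (by norm_num) (by norm_num) (by norm_num) (by norm_num)
      (by norm_num) (by intro a b c h1 h2 h3 h4 h5 h6; norm_num at h6; interval_cases a <;> interval_cases b <;> omega) p e
  · exact finish _ 3 1 2 1 4 2 1 2 1 (by intro v; simp only [Qf]; norm_num) (by rfl) (by rfl) (by norm_num) (by norm_num)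
      (by norm_num) (by norm_num) (by norm_num) (by norm_num) (by norm_num) (by norm_num)
      (by norm_num) (by intro a b c h1 h2 h3 h4 h5 h6; norm_num at h6; interval_cases a <;> interval_cases b <;> omega) p e
  · exact finish _ 2 0 11 0 22 2 0 11 0 (by intro v; simp only [Qf]; norm_num) (by rfl) (by rfl) (by norm_num) (by norm_num)
      (by norm_num) (by norm_num) (by norm_num) (by norm_num) (by norm_num) (by norm_num)
      (by norm_num) (by intro a b c h1 h2 h3 h4 h5 h6; norm_num at h6; interval_cases a <;> interval_cases b <;> omega) p e
  · exact finish _ 5 1 3 1 9 3 1 3 2 (by intro v; simp only [Qf]; norm_num) (by rfl) (by rfl) (by norm_num) (by norm_num)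
      (by norm_num) (by norm_num) (by norm_num) (by norm_num) (by norm_num) (by norm_num)
      (by norm_num) (by intro a b c h1 h2 h3 h4 h5 h6; norm_num at h6; interval_cases a <;> interval_cases b <;> omega) p e
  · exact finish _ 2 1 19 0 37 2 2 19 1 (by intro v; simp only [Qf]; norm_num) (by rfl) (by rfl) (by norm_num) (by norm_num)
      (by norm_num) (by norm_num) (by norm_num) (by norm_num) (by norm_num) (by norm_num)
      (by norm_num) (by intro a b c h1 h2 h3 h4 h5 h6; norm_num at h6; interval_cases a <;> interval_cases b <;> omega) p e
  · exact finish _ 3 1 5 1 13 3 3 5 1 (by intro v; simp only [Qf]; norm_num) (by rfl) (by rfl) (by norm_num) (by norm_num)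
      (by norm_num) (by norm_num) (by norm_num) (by norm_num) (by norm_num) (by norm_num)
      (by norm_num) (by intro a b c h1 h2 h3 h4 h5 h6; norm_num at h6; interval_cases a <;> interval_cases b <;> omega) p e
  · exact finish _ 2 0 29 0 58 2 0 29 0 (by intro v; simp only [Qf]; norm_num) (by rfl) (by rfl) (by norm_num) (by norm_num)
      (by norm_num) (by norm_num) (by norm_num) (by norm_num) (by norm_num) (by norm_num)
      (by norm_num) (by intro a b c h1 h2 h3 h4 h5 h6; norm_num at h6; interval_cases a <;> interval_cases b <;> omega) p e
  · exact finish _ 7 1 5 1 23 5 3 5 3 (by intro v; simp only [Qf]; norm_num) (by rfl) (by rfl) (by norm_num) (by norm_num)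
      (by norm_num) (by norm_num) (by norm_num) (by norm_num) (by norm_num) (by norm_num)
      (by norm_num) (by intro a b c h1 h2 h3 h4 h5 h6; norm_num at h6; interval_cases a <;> interval_cases b <;> omega) p e
  · exact finish _ 5 1 7 1 29 5 5 7 2 (by intro v; simp only [Qf]; norm_num) (by rfl) (by rfl) (by norm_num) (by norm_num)
      (by norm_num) (by norm_num) (by norm_num) (by norm_num) (by norm_num) (by norm_num)
      (by norm_num) (by intro a b c h1 h2 h3 h4 h5 h6; norm_num at h6; interval_cases a <;> interval_cases b <;> omega) p e
  · exact finish _ 3 1 11 1 31 3 3 11 1 (by intro v; simp only [Qf]; norm_num) (by rfl) (by rfl) (by norm_num) (by norm_num)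
      (by norm_num) (by norm_num) (by norm_num) (by norm_num) (by norm_num) (by norm_num)
      (by norm_num) (by intro a b c h1 h2 h3 h4 h5 h6; norm_num at h6; interval_cases a <;> interval_cases b <;> omega) p e
  · exact finish _ 11 1 7 1 47 7 3 7 5 (by intro v; simp only [Qf]; norm_num) (by rfl) (by rfl) (by norm_num) (by norm_num)
      (by norm_num) (by norm_num) (by norm_num) (by norm_num) (by norm_num) (by norm_num)
      (by norm_num) (by intro a b c h1 h2 h3 h4 h5 h6; norm_num at h6; interval_cases a <;> interval_cases b <;> omega) p e
  · exact finish _ 5 1 13 1 59 5 5 13 2 (by intro v; simp only [Qf]; norm_num) (by rfl) (by rfl) (by norm_num) (by norm_num)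
      (by norm_num) (by norm_num) (by norm_num) (by norm_num) (by norm_num) (by norm_num)
      (by norm_num) (by intro a b c h1 h2 h3 h4 h5 h6; norm_num at h6; interval_cases a <;> interval_cases b <;> omega) p e
  · exact finish _ 3 1 23 1 67 3 3 23 1 (by intro v; simp only [Qf]; norm_num) (by rfl) (by rfl) (by norm_num) (by norm_num)
      (by norm_num) (by norm_num) (by norm_num) (by norm_num) (by norm_num) (by norm_num)
      (by norm_num) (by intro a b c h1 h2 h3 h4 h5 h6; norm_num at h6; interval_cases a <;> interval_cases b <;> omega) p e
  · exact finish _ 13 1 11 1 101 11 9 11 6 (by intro v; simp only [Qf]; norm_num) (by rfl) (by rfl) (by norm_num) (by norm_num)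
      (by norm_num) (by norm_num) (by norm_num) (by norm_num) (by norm_num) (by norm_num)
      (by norm_num) (by intro a b c h1 h2 h3 h4 h5 h6; norm_num at h6; interval_cases a <;> interval_cases b <;> omega) p e
  · exact finish _ 7 1 17 1 107 7 7 17 3 (by intro v; simp only [Qf]; norm_num) (by rfl) (by rfl) (by norm_num) (by norm_num)
      (by norm_num) (by norm_num) (by norm_num) (by norm_num) (by norm_num) (by norm_num)
      (by norm_num) (by intro a b c h1 h2 h3 h4 h5 h6; norm_num at h6; interval_cases a <;> interval_cases b <;> omega) p e
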